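/- arXiv:2305.06192 — 2 statements merged into one kernel-verified Lean document; each statement's English description precedes it below -/
import Mathlib

section
/- Let d ≥ 2 and let F : EuclideanSpace ℝ (Fin d) → EuclideanSpace ℝ (Fin d) be a vector field each of whose components is a Schwartz function. Let Φ = div F. Then for every orthonormal basis (ω, ω_1, …, ω_{d−1}) of ℝ^d and every p ∈ ℝ: for each k the function p' ↦ [W_{ω_k}^⊥F](ω,p') is differentiable, and the componentwise Radon transform of F is given by [𝕽F](ω,p) = [D^⊥F](ω,p) • ω + Σ_{k=1}^{d−1} ( d/dp [W_{ω_k}^⊥F](ω,p) − [R(x ↦ ⟪ω_k,x⟫·Φ(x))](ω,p) ) • ω_k. -/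
open MeasureTheory Real
open scoped RealInnerProductSpace

noncomputable section

/-- The `j`-th canonical basis vector of `ℝ^d`. -/
def canE (d : ℕ) (j : Fin d) : EuclideanSpace ℝ (Fin d) := EuclideanSpace.single j 1

/-- Divergence of a vector field on `ℝ^d`: `div F x = ∑ⱼ ∂Fⱼ/∂xⱼ (x)`. -/
def vdiv {d : ℕ} (F : EuclideanSpace ℝ (Fin d) → EuclideanSpace ℝ (Fin d))
    (x : EuclideanSpace ℝ (Fin d)) : ℝ :=
  ∑ j, fderiv ℝ (fun y => ⟪canE d j, F y⟫) x (canE d j)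

/-- Laplacian of a scalar function on `ℝ^d` (sum of second partial derivatives). -/
def lap {d : ℕ} (f : EuclideanSpace ℝ (Fin d) → ℝ) (x : EuclideanSpace ℝ (Fin d)) : ℝ :=
  ∑ j, fderiv ℝ (fun y => fderiv ℝ f y (canE d j)) x (canE d j)

/-- A function is a Schwartz function if it agrees with an element of the Schwartz space. -/
def IsSchwartz {d : ℕ} (f : EuclideanSpace ℝ (Fin d) → ℝ) : Prop :=
  ∃ g : SchwartzMap (EuclideanSpace ℝ (Fin d)) ℝ, ∀ x, f x = g x

/-- The fundamental solution of the Laplace equation in `ℝ^d`, `d ≥ 3`: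
`G(x) = −(Γ(d/2−1)/(4 π^{d/2})) ‖x‖^{2−d}`. -/
def fundSol (d : ℕ) (x : EuclideanSpace ℝ (Fin d)) : ℝ :=
  -(Real.Gamma ((d : ℝ) / 2 - 1) / (4 * Real.pi ^ ((d : ℝ) / 2))) * ‖x‖ ^ ((2 : ℝ) - d)

/-- The Radon transform of a scalar function: integral over the hyperplane `⟪x,ω⟫ = p`,
parametrized as `x = p•ω + y`, `y ∈ (ℝ∙ω)ᗮ`. -/
def RadonT {d : ℕ} (f : EuclideanSpace ℝ (Fin d) → ℝ) (ω : EuclideanSpace ℝ (Fin d))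
    (p : ℝ) : ℝ :=
  ∫ y : ((ℝ ∙ ω)ᗮ : Submodule ℝ (EuclideanSpace ℝ (Fin d))),
    f (p • ω + (y : EuclideanSpace ℝ (Fin d)))

/-- The componentwise (vector-valued, Bochner) Radon transform of a vector field. -/
def RadonVec {d : ℕ} (F : EuclideanSpace ℝ (Fin d) → EuclideanSpace ℝ (Fin d))
    (ω : EuclideanSpace ℝ (Fin d)) (p : ℝ) : EuclideanSpace ℝ (Fin d) :=
  ∫ y : ((ℝ ∙ ω)ᗮ : Submodule ℝ (EuclideanSpace ℝ (Fin d))),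
    F (p • ω + (y : EuclideanSpace ℝ (Fin d)))

/-- The transversal Radon transform `[D^⊥F](ω,p)`. -/
def Dperp {d : ℕ} (F : EuclideanSpace ℝ (Fin d) → EuclideanSpace ℝ (Fin d))
    (ω : EuclideanSpace ℝ (Fin d)) (p : ℝ) : ℝ :=
  RadonT (fun x => ⟪ω, F x⟫) ω p

/-- The longitudinal Radon transform `[D_θ^∥F](ω,p)` for a direction `θ` orthogonal to `ω`. -/
def Dlong {d : ℕ} (F : EuclideanSpace ℝ (Fin d) → EuclideanSpace ℝ (Fin d))
    (ω θ : EuclideanSpace ℝ (Fin d)) (p : ℝ) : ℝ :=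
  RadonT (fun x => ⟪θ, F x⟫) ω p

/-- The weighted transversal Radon transform `[W_θ^⊥F](ω,p)` with linear weight `⟪θ,x⟫`. -/
def Wperp {d : ℕ} (F : EuclideanSpace ℝ (Fin d) → EuclideanSpace ℝ (Fin d))
    (ω θ : EuclideanSpace ℝ (Fin d)) (p : ℝ) : ℝ :=
  RadonT (fun x => ⟪θ, x⟫ * ⟪ω, F x⟫) ω p

/-- The weighted longitudinal Radon transform `[W_θ^∥F](ω,p)` with linear weight `⟪θ,x⟫`. -/
def Wlong {d : ℕ} (F : EuclideanSpace ℝ (Fin d) → EuclideanSpace ℝ (Fin d))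
    (ω θ : EuclideanSpace ℝ (Fin d)) (p : ℝ) : ℝ :=
  RadonT (fun x => ⟪θ, x⟫ * ⟪θ, F x⟫) ω p

open scoped LineDeriv SchwartzMap

/-- Schwartz functions restricted to a hyperplane. -/
def hypRestr {d : ℕ} (h : 𝓢(EuclideanSpace ℝ (Fin d), ℝ)) (ω : EuclideanSpace ℝ (Fin d))
    (p : ℝ) : 𝓢(((ℝ ∙ ω)ᗮ : Submodule ℝ (EuclideanSpace ℝ (Fin d))), ℝ) :=
  SchwartzMap.compCLMOfAntilipschitz (K := 1) ℝ
    (g := fun y : ((ℝ ∙ ω)ᗮ : Submodule ℝ (EuclideanSpace ℝ (Fin d))) =>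
      p • ω + (y : EuclideanSpace ℝ (Fin d)))
    ((Function.HasTemperateGrowth.const _).add
      (((ℝ ∙ ω)ᗮ : Submodule ℝ (EuclideanSpace ℝ (Fin d))).subtypeL.hasTemperateGrowth))
    (fun x y => by simp [edist_dist, dist_eq_norm]) h

lemma hypRestr_apply {d : ℕ} (h : 𝓢(EuclideanSpace ℝ (Fin d), ℝ))
    (ω : EuclideanSpace ℝ (Fin d)) (p : ℝ)
    (y : ((ℝ ∙ ω)ᗮ : Submodule ℝ (EuclideanSpace ℝ (Fin d)))) :
    hypRestr h ω p y = h (p • ω + (y : EuclideanSpace ℝ (Fin d))) := rfl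

lemma hyp_integrable {d : ℕ} (h : 𝓢(EuclideanSpace ℝ (Fin d), ℝ))
    (ω : EuclideanSpace ℝ (Fin d)) (p : ℝ) :
    Integrable (fun y : ((ℝ ∙ ω)ᗮ : Submodule ℝ (EuclideanSpace ℝ (Fin d))) =>
      h (p • ω + (y : EuclideanSpace ℝ (Fin d)))) :=
  (hypRestr h ω p).integrable

lemma radon_tangent {d : ℕ} (h : 𝓢(EuclideanSpace ℝ (Fin d), ℝ))
    (ω v : EuclideanSpace ℝ (Fin d)) (hv : ⟪ω, v⟫ = 0) (p : ℝ) :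
    RadonT (fun x => fderiv ℝ h x v) ω p = 0 := by
  have hvm : v ∈ ((ℝ ∙ ω)ᗮ : Submodule ℝ (EuclideanSpace ℝ (Fin d))) :=
    Submodule.mem_orthogonal_singleton_iff_inner_right.2 hv
  set v' : ((ℝ ∙ ω)ᗮ : Submodule ℝ (EuclideanSpace ℝ (Fin d))) := ⟨v, hvm⟩
  have key : ∀ y : ((ℝ ∙ ω)ᗮ : Submodule ℝ (EuclideanSpace ℝ (Fin d))),
      fderiv ℝ h (p • ω + (y : EuclideanSpace ℝ (Fin d))) v
        = fderiv ℝ (hypRestr h ω p) y v' := by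
    intro y
    have h1 : HasFDerivAt (fun y : ((ℝ ∙ ω)ᗮ : Submodule ℝ (EuclideanSpace ℝ (Fin d))) =>
        p • ω + (y : EuclideanSpace ℝ (Fin d)))
        ((ℝ ∙ ω)ᗮ : Submodule ℝ (EuclideanSpace ℝ (Fin d))).subtypeL y :=
      (((ℝ ∙ ω)ᗮ : Submodule ℝ (EuclideanSpace ℝ (Fin d))).subtypeL.hasFDerivAt).const_add _
    have h2 := (h.hasFDerivAt (p • ω + (y : EuclideanSpace ℝ (Fin d)))).comp y h1
    have h3 : HasFDerivAt (hypRestr h ω p) _ y := h2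
    rw [h3.fderiv]; rfl
  unfold RadonT
  simp_rw [key]
  have hint : Integrable (fun y => fderiv ℝ (hypRestr h ω p) y v') :=
    (∂_{v'} (hypRestr h ω p)).integrable
  have := integral_mul_fderiv_eq_neg_fderiv_mul_of_integrable
    (μ := (volume : Measure ((ℝ ∙ ω)ᗮ : Submodule ℝ (EuclideanSpace ℝ (Fin d)))))
    (𝕜 := ℝ) (f := fun _ => (1 : ℝ)) (g := hypRestr h ω p) (v := v')
    (by simp) (by simpa using hint) (by simpa using (hypRestr h ω p).integrable)
    (by fun_prop) (fun x _ => (hypRestr h ω p).differentiable x)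
  simpa using this

lemma hyp_norm_le {d : ℕ} (ω : EuclideanSpace ℝ (Fin d)) (p : ℝ)
    (y : ((ℝ ∙ ω)ᗮ : Submodule ℝ (EuclideanSpace ℝ (Fin d)))) :
    ‖y‖ ≤ ‖p • ω + (y : EuclideanSpace ℝ (Fin d))‖ := by
  have h0 : ⟪p • ω, (y : EuclideanSpace ℝ (Fin d))⟫ = 0 := by
    rw [inner_smul_left, Submodule.mem_orthogonal_singleton_iff_inner_right.1 y.2, mul_zero]
  have h1 := norm_add_sq_eq_norm_sq_add_norm_sq_real h0
  have h2 : ‖y‖ = ‖(y : EuclideanSpace ℝ (Fin d))‖ := rfl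
  rw [h2]
  nlinarith [norm_nonneg (p • ω + (y : EuclideanSpace ℝ (Fin d))),
    norm_nonneg (y : EuclideanSpace ℝ (Fin d)), mul_self_nonneg ‖p • ω‖]

lemma radon_hasDerivAt {d : ℕ} (h : 𝓢(EuclideanSpace ℝ (Fin d), ℝ))
    (ω : EuclideanSpace ℝ (Fin d)) (p : ℝ) :
    HasDerivAt (fun q => RadonT h ω q) (RadonT (fun x => fderiv ℝ h x ω) ω p) p := by
  set V := ((ℝ ∙ ω)ᗮ : Submodule ℝ (EuclideanSpace ℝ (Fin d)))
  set n : ℕ := Module.finrank ℝ V + 1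
  obtain ⟨C, hC⟩ : ∃ C : ℝ, ∀ x, (1 + ‖x‖) ^ n * ‖(∂_{ω} h) x‖ ≤ C := by
    refine ⟨2 ^ n * (Finset.Iic (n, 0)).sup
      (fun m : ℕ × ℕ => SchwartzMap.seminorm ℝ m.1 m.2) (∂_{ω} h), fun x => ?_⟩
    have := SchwartzMap.one_add_le_sup_seminorm_apply (𝕜 := ℝ) (m := (n, 0)) (k := n) (n := 0)
      le_rfl le_rfl (∂_{ω} h) x
    rw [norm_iteratedFDeriv_zero] at this
    exact this
  refine (hasDerivAt_integral_of_dominated_loc_of_deriv_le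
    (F := fun q (y : V) => h (q • ω + (y : EuclideanSpace ℝ (Fin d))))
    (F' := fun q (y : V) => fderiv ℝ h (q • ω + (y : EuclideanSpace ℝ (Fin d))) ω)
    (bound := fun y : V => C * (1 + ‖y‖) ^ (-(n : ℝ))) (s := Set.univ)
    Filter.univ_mem ?_ ?_ ?_ ?_ ?_ ?_).2
  · exact Filter.Eventually.of_forall fun q => (hyp_integrable h ω q).aestronglyMeasurable
  · exact hyp_integrable h ω p
  · exact (hyp_integrable (∂_{ω} h) ω p).aestronglyMeasurable
  · refine Filter.Eventually.of_forall fun y q _ => ?_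
    have h1 := hC (q • ω + (y : EuclideanSpace ℝ (Fin d)))
    rw [Real.rpow_neg (by positivity), Real.rpow_natCast, ← div_eq_mul_inv,
      le_div_iff₀ (by positivity), mul_comm]
    refine le_trans ?_ h1
    have := hyp_norm_le ω q y
    rw [SchwartzMap.lineDerivOp_apply_eq_fderiv]
    gcongr
  · exact (integrable_one_add_norm (by simp [n])).const_mul C
  · refine Filter.Eventually.of_forall fun y q _ => ?_
    have h1 : HasDerivAt (fun q : ℝ => q • ω + (y : EuclideanSpace ℝ (Fin d))) ω q := by
      simpa using ((hasDerivAt_id q).smul_const ω).add_const (y : EuclideanSpace ℝ (Fin d))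
    exact (h.hasFDerivAt _).comp_hasDerivAt q h1

/-- reconstruction of the componentwise Radon transform of `F` from the
transversal transform and the weighted transversal transforms:
`[𝕽F](ω,p) = [D^⊥F](ω,p) • ω + Σ_{k≠i₀} (d/dp [W_{ω_k}^⊥F](ω,p) − [R(⟪ω_k,x⟫Φ)](ω,p)) • ω_k`. -/
theorem stmt11 (d : ℕ) (hd : 2 ≤ d)
    (F : EuclideanSpace ℝ (Fin d) → EuclideanSpace ℝ (Fin d))
    (hF : ∀ j : Fin d, IsSchwartz (fun x => ⟪canE d j, F x⟫))
    (Φ : EuclideanSpace ℝ (Fin d) → ℝ) (hΦ : ∀ x, Φ x = vdiv F x)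
    (b : OrthonormalBasis (Fin d) ℝ (EuclideanSpace ℝ (Fin d))) (i₀ : Fin d) (p : ℝ) :
    (∀ k : Fin d, k ≠ i₀ → ∀ q : ℝ,
        DifferentiableAt ℝ (fun p' => Wperp F (b i₀) (b k) p') q) ∧
      RadonVec F (b i₀) p = (Dperp F (b i₀) p) • b i₀ +
        ∑ k ∈ Finset.univ.erase i₀,
          (deriv (fun p' => Wperp F (b i₀) (b k) p') p -
            RadonT (fun x => ⟪b k, x⟫ * Φ x) (b i₀) p) • b k := by
  classical
  choose g hg using hF
  -- components in the basis `b`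
  set G : Fin d → 𝓢(EuclideanSpace ℝ (Fin d), ℝ) := fun i => ∑ j, ⟪b i, canE d j⟫ • g j with hGdef
  have hFsum : ∀ x, F x = ∑ j, g j x • canE d j := by
    intro x
    have := (EuclideanSpace.basisFun (Fin d) ℝ).sum_repr' (F x)
    rw [← this]
    refine Finset.sum_congr rfl fun j _ => ?_
    rw [← hg j x]
    simp [canE]
  have hG : ∀ i x, ⟪b i, F x⟫ = G i x := by
    intro i x
    rw [hFsum, inner_sum]
    simp [hGdef, inner_smul_right, mul_comm]
  have hFd : Differentiable ℝ F := by
    have : F = fun x => ∑ j, g j x • canE d j := funext hFsum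
    rw [this]
    have hgd : ∀ j, Differentiable ℝ (g j) := fun j => (g j).differentiable
    fun_prop
  have hinner : ∀ (u x v : EuclideanSpace ℝ (Fin d)),
      fderiv ℝ (fun y => ⟪u, F y⟫) x v = ⟪u, fderiv ℝ F x v⟫ := by
    intro u x v
    have h1 : HasFDerivAt (fun y => ⟪u, F y⟫) _ x :=
      (innerSL ℝ u).hasFDerivAt.comp x (hFd x).hasFDerivAt
    rw [h1.fderiv]; rfl
  have hdiv : ∀ x, Φ x = ∑ j, fderiv ℝ (G j) x (b j) := by
    intro x
    have e1 := LinearMap.trace_eq_sum_inner (fderiv ℝ F x).toLinearMap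
      (EuclideanSpace.basisFun (Fin d) ℝ)
    have e2 := LinearMap.trace_eq_sum_inner (fderiv ℝ F x).toLinearMap b
    have e3 : ∀ j, fderiv ℝ (G j) x (b j) = ⟪b j, fderiv ℝ F x (b j)⟫ := by
      intro j
      rw [← hinner]
      congr 2
      funext y; exact (hG j y).symm
    rw [hΦ, vdiv]
    simp_rw [hinner, e3]
    rw [e1] at e2
    simpa [canE] using e2
  -- multiplication by the weight
  have htemp : ∀ k, Function.HasTemperateGrowth (fun x : EuclideanSpace ℝ (Fin d) => ⟪b k, x⟫) :=
    fun k => (innerSL ℝ (b k)).hasTemperateGrowth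
  set M : Fin d → Fin d → 𝓢(EuclideanSpace ℝ (Fin d), ℝ) :=
    fun k i => SchwartzMap.smulLeftCLM ℝ (fun x => ⟪b k, x⟫) (G i) with hM
  have hMa : ∀ k i x, M k i x = ⟪b k, x⟫ * G i x := by
    intro k i x
    simp only [hM]
    rw [SchwartzMap.smulLeftCLM_apply_apply (htemp k), smul_eq_mul]
  have hMd : ∀ k i x v, fderiv ℝ (M k i) x v
      = ⟪b k, x⟫ * fderiv ℝ (G i) x v + ⟪b k, v⟫ * G i x := by
    intro k i x v
    have h1 : HasFDerivAt (fun y => ⟪b k, y⟫ * G i y) _ x :=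
      (innerSL ℝ (b k)).hasFDerivAt.mul ((G i).hasFDerivAt x)
    have h2 : (M k i : EuclideanSpace ℝ (Fin d) → ℝ) = fun y => ⟪b k, y⟫ * G i y :=
      funext (hMa k i)
    rw [h2, h1.fderiv]
    simp [mul_comm]
  have hW : ∀ k, (fun p' => Wperp F (b i₀) (b k) p') = fun p' => RadonT (M k i₀) (b i₀) p' := by
    intro k
    funext q
    unfold Wperp
    congr 1
    funext x
    rw [hMa, hG]
  refine ⟨fun k _ q => ?_, ?_⟩
  · rw [hW]
    exact (radon_hasDerivAt _ _ _).differentiableAt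
  have hmain : ∀ k, deriv (fun p' => Wperp F (b i₀) (b k) p') p -
      RadonT (fun x => ⟪b k, x⟫ * Φ x) (b i₀) p = RadonT (G k) (b i₀) p := by
    intro k
    rw [hW, (radon_hasDerivAt _ _ _).deriv]
    have e1 : ∀ x, ⟪b k, x⟫ * Φ x = ∑ j, fderiv ℝ (M k j) x (b j) - G k x := by
      intro x
      simp_rw [hMd, Finset.sum_add_distrib, hdiv, Finset.mul_sum]
      simp [b.inner_eq_ite]
    have e2 : RadonT (fun x => ⟪b k, x⟫ * Φ x) (b i₀) p
        = ∑ j, RadonT (fun x => fderiv ℝ (M k j) x (b j)) (b i₀) p - RadonT (G k) (b i₀) p := by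
      have hi : ∀ j, Integrable (fun y : ((ℝ ∙ (b i₀))ᗮ :
          Submodule ℝ (EuclideanSpace ℝ (Fin d))) =>
          fderiv ℝ (M k j) (p • b i₀ + (y : EuclideanSpace ℝ (Fin d))) (b j)) :=
        fun j => hyp_integrable (∂_{b j} (M k j)) _ _
      unfold RadonT
      simp_rw [e1]
      rw [integral_sub (integrable_finsetSum _ fun j _ => hi j) (hyp_integrable _ _ _),
        integral_finsetSum _ fun j _ => hi j]
    rw [e2, Finset.sum_eq_single i₀]
    · ring
    · intro j _ hj
      exact radon_tangent _ _ _ (by rw [b.inner_eq_ite, if_neg hj.symm]) _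
    · simp
  simp_rw [hmain]
  have hD : Dperp F (b i₀) p = RadonT (G i₀) (b i₀) p := by
    unfold Dperp
    congr 1
    funext x; exact hG _ _
  have hint : Integrable (fun y : ((ℝ ∙ (b i₀))ᗮ : Submodule ℝ (EuclideanSpace ℝ (Fin d))) =>
      F (p • b i₀ + (y : EuclideanSpace ℝ (Fin d)))) := by
    simp_rw [hFsum]
    exact integrable_finsetSum _ fun j _ => (hyp_integrable (g j) _ _).smul_const _
  rw [hD, Finset.add_sum_erase _ (fun k => RadonT (G k) (b i₀) p • b k) (Finset.mem_univ i₀),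
    ← b.sum_repr' (RadonVec F (b i₀) p)]
  refine Finset.sum_congr rfl fun k _ => ?_
  congr 1
  unfold RadonVec RadonT
  rw [← integral_inner hint]
  simp_rw [hG]
end
end

section
/- Let d ≥ 2 and let F : EuclideanSpace ℝ (Fin d) → EuclideanSpace ℝ (Fin d) be a vector field each of whose components is a Schwartz function. Let Φ = div F and define Ψ : ℝ^d → ℝ^d componentwise by ⟪e_j, Ψ(x)⟫ = Δ(F_j)(x) − ∂Φ/∂x_j(x), where F_j(x) = ⟪e_j, F(x)⟫. Then for every pair of orthonormal vectors ω, ω_1 in ℝ^d and every p ∈ ℝ, the function p' ↦ [W_{ω_1}^∥F](ω,p') is twice differentiable, and the Radon transform of the divergence is given by [RΦ](ω,p) = [R(x ↦ ⟪x,ω_1⟫·⟪ω_1,Ψ(x)⟫)](ω,p) − d²/dp² [W_{ω_1}^∥F](ω,p). -/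
open MeasureTheory Real
open scoped RealInnerProductSpace

noncomputable section

open scoped LineDeriv SchwartzMap

theorem aux_norm_le {d : ℕ} (ω : EuclideanSpace ℝ (Fin d)) (q : ℝ)
    (y : ((ℝ ∙ ω)ᗮ : Submodule ℝ (EuclideanSpace ℝ (Fin d)))) :
    ‖y‖ ≤ ‖q • ω + (y : EuclideanSpace ℝ (Fin d))‖ := by
  have h0 : ⟪q • ω, (y : EuclideanSpace ℝ (Fin d))⟫ = 0 := by
    rw [inner_smul_left, Submodule.mem_orthogonal_singleton_iff_inner_right.1 y.2, mul_zero]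
  have h := norm_add_sq_eq_norm_sq_add_norm_sq_of_inner_eq_zero _ _ h0
  have : ‖y‖ = ‖(y : EuclideanSpace ℝ (Fin d))‖ := rfl
  rw [this]
  nlinarith [norm_nonneg (q • ω), norm_nonneg (q • ω + (y : EuclideanSpace ℝ (Fin d))),
    norm_nonneg (y : EuclideanSpace ℝ (Fin d))]

theorem aux_bound {d : ℕ} (ω : EuclideanSpace ℝ (Fin d))
    (f : 𝓢(EuclideanSpace ℝ (Fin d), ℝ)) :
    ∃ b : ((ℝ ∙ ω)ᗮ : Submodule ℝ (EuclideanSpace ℝ (Fin d))) → ℝ, Integrable b ∧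
      ∀ (q : ℝ) (y : ((ℝ ∙ ω)ᗮ : Submodule ℝ (EuclideanSpace ℝ (Fin d)))),
        ‖f (q • ω + (y : EuclideanSpace ℝ (Fin d)))‖ ≤ b y := by
  let n := (volume : Measure ((ℝ ∙ ω)ᗮ : Submodule ℝ (EuclideanSpace ℝ (Fin d)))).integrablePower
  let C : ℝ := 2 ^ n * ((Finset.Iic (n, 0)).sup
    (fun m' : ℕ × ℕ => SchwartzMap.seminorm ℝ m'.1 m'.2) f)
  refine ⟨fun y => (1 + ‖y‖) ^ (-(n : ℝ)) * C,
    (Measure.integrable_pow_neg_integrablePower _).mul_const _, fun q y => ?_⟩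
  beta_reduce
  rw [rpow_neg (by positivity), ← div_eq_inv_mul, le_div_iff₀' (by positivity), rpow_natCast]
  have h := SchwartzMap.one_add_le_sup_seminorm_apply (𝕜 := ℝ) (m := (n, 0)) (k := n) (n := 0)
    le_rfl le_rfl f (q • ω + (y : EuclideanSpace ℝ (Fin d)))
  rw [norm_iteratedFDeriv_zero] at h
  refine le_trans ?_ h
  gcongr
  exact aux_norm_le ω q y

theorem aux_cont {d : ℕ} (ω : EuclideanSpace ℝ (Fin d))
    (f : 𝓢(EuclideanSpace ℝ (Fin d), ℝ)) (q : ℝ) :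
    Continuous (fun y : ((ℝ ∙ ω)ᗮ : Submodule ℝ (EuclideanSpace ℝ (Fin d))) =>
      f (q • ω + (y : EuclideanSpace ℝ (Fin d)))) :=
  f.continuous.comp (continuous_const.add continuous_subtype_val)

theorem aux_integrable {d : ℕ} (ω : EuclideanSpace ℝ (Fin d))
    (f : 𝓢(EuclideanSpace ℝ (Fin d), ℝ)) (q : ℝ) :
    Integrable (fun y : ((ℝ ∙ ω)ᗮ : Submodule ℝ (EuclideanSpace ℝ (Fin d))) =>
      f (q • ω + (y : EuclideanSpace ℝ (Fin d)))) := by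
  obtain ⟨b, hb, h⟩ := aux_bound ω f
  exact hb.mono' (aux_cont ω f q).aestronglyMeasurable (.of_forall (h q))

/-- The Radon transform as a linear functional on Schwartz space. -/
def RL {d : ℕ} (ω : EuclideanSpace ℝ (Fin d)) (p : ℝ) :
    𝓢(EuclideanSpace ℝ (Fin d), ℝ) →ₗ[ℝ] ℝ where
  toFun f := RadonT f ω p
  map_add' f g := by
    simp only [RadonT, SchwartzMap.add_apply]
    exact integral_add (aux_integrable ω f p) (aux_integrable ω g p)
  map_smul' c f := by
    simp only [RadonT, SchwartzMap.smul_apply, RingHom.id_apply, smul_eq_mul]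
    exact integral_const_mul _ _

theorem RL_hasDerivAt {d : ℕ} (ω : EuclideanSpace ℝ (Fin d))
    (f : 𝓢(EuclideanSpace ℝ (Fin d), ℝ)) (p : ℝ) :
    HasDerivAt (fun q => RL ω q f) (RL ω p (∂_{ω} f)) p := by
  obtain ⟨b, hb, h⟩ := aux_bound ω (∂_{ω} f)
  refine (hasDerivAt_integral_of_dominated_loc_of_deriv_le (s := Set.univ) (bound := b)
    Filter.univ_mem
    (.of_forall fun q => (aux_cont ω f q).aestronglyMeasurable)
    (aux_integrable ω f p) (F' := fun q y => (∂_{ω} f) (q • ω + (y : EuclideanSpace ℝ (Fin d))))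
    (aux_cont ω (∂_{ω} f) p).aestronglyMeasurable
    (.of_forall fun y q _ => h q y) hb (.of_forall fun y q _ => ?_)).2
  have h1 : HasDerivAt (fun q : ℝ => q • ω + (y : EuclideanSpace ℝ (Fin d))) ω q := by
    simpa using ((hasDerivAt_id q).smul_const ω).add_const (y : EuclideanSpace ℝ (Fin d))
  rw [SchwartzMap.lineDerivOp_apply_eq_fderiv]
  exact f.differentiableAt.hasFDerivAt.comp_hasDerivAt q h1

theorem RL_orth {d : ℕ} (ω v : EuclideanSpace ℝ (Fin d)) (hv : ⟪ω, v⟫ = 0)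
    (f : 𝓢(EuclideanSpace ℝ (Fin d), ℝ)) (p : ℝ) :
    RL ω p (∂_{v} f) = 0 := by
  let w : ((ℝ ∙ ω)ᗮ : Submodule ℝ (EuclideanSpace ℝ (Fin d))) :=
    ⟨v, Submodule.mem_orthogonal_singleton_iff_inner_right.2 hv⟩
  have := integral_bilinear_hasLineDerivAt_right_eq_neg_left_of_integrable
    (μ := (volume : Measure ((ℝ ∙ ω)ᗮ : Submodule ℝ (EuclideanSpace ℝ (Fin d)))))
    (f := fun _ => (1 : ℝ)) (f' := fun _ => (0 : ℝ)) (v := w)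
    (g := fun y => f (p • ω + (y : EuclideanSpace ℝ (Fin d))))
    (g' := fun y => (∂_{v} f) (p • ω + (y : EuclideanSpace ℝ (Fin d))))
    (B := ContinuousLinearMap.mul ℝ ℝ) (by simp)
    (by simpa using aux_integrable ω (∂_{v} f) p)
    (by simpa using aux_integrable ω f p)
    (fun x _ => by simpa using (hasFDerivAt_const (1 : ℝ) x).hasLineDerivAt w)
    (fun x _ => by
      rw [SchwartzMap.lineDerivOp_apply_eq_fderiv]
      have h1 : HasFDerivAt (fun y : ((ℝ ∙ ω)ᗮ : Submodule ℝ (EuclideanSpace ℝ (Fin d))) =>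
          p • ω + (y : EuclideanSpace ℝ (Fin d))) ((ℝ ∙ ω)ᗮ).subtypeL x :=
        (((ℝ ∙ ω)ᗮ).subtypeL.hasFDerivAt).const_add _
      have h2 := (f.differentiableAt (x := p • ω + (x : EuclideanSpace ℝ (Fin d)))).hasFDerivAt.comp
        x h1
      exact h2.hasLineDerivAt w)
  simp only [ContinuousLinearMap.mul_apply', one_mul, zero_mul, integral_zero, neg_zero] at this
  exact this

theorem RL_dir {d : ℕ} (ω v : EuclideanSpace ℝ (Fin d)) (hω : ‖ω‖ = 1)
    (f : 𝓢(EuclideanSpace ℝ (Fin d), ℝ)) (p : ℝ) :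
    RL ω p (∂_{v} f) = ⟪ω, v⟫ * RL ω p (∂_{ω} f) := by
  have h0 : ⟪ω, v - ⟪ω, v⟫ • ω⟫ = 0 := by
    rw [inner_sub_right, inner_smul_right, real_inner_self_eq_norm_sq, hω]; ring
  have h := RL_orth ω _ h0 f p
  have h1 : ∂_{v} f = ∂_{v - ⟪ω, v⟫ • ω} f + ⟪ω, v⟫ • ∂_{ω} f := by
    ext x
    simp [SchwartzMap.lineDerivOp_apply_eq_fderiv]
  rw [h1, map_add, h, map_smul, zero_add, smul_eq_mul]

/-- Multiplication by a linear weight on Schwartz space. -/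
def Mw {d : ℕ} (θ : EuclideanSpace ℝ (Fin d)) :
    𝓢(EuclideanSpace ℝ (Fin d), ℝ) →L[ℝ] 𝓢(EuclideanSpace ℝ (Fin d), ℝ) :=
  SchwartzMap.smulLeftCLM ℝ (fun x => ⟪x, θ⟫)

theorem Mw_apply {d : ℕ} (θ : EuclideanSpace ℝ (Fin d))
    (f : 𝓢(EuclideanSpace ℝ (Fin d), ℝ)) (x : EuclideanSpace ℝ (Fin d)) :
    Mw θ f x = ⟪x, θ⟫ * f x := by
  rw [Mw, SchwartzMap.smulLeftCLM_apply_apply (by fun_prop), smul_eq_mul]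

theorem Mw_deriv {d : ℕ} (θ v : EuclideanSpace ℝ (Fin d))
    (f : 𝓢(EuclideanSpace ℝ (Fin d), ℝ)) :
    ∂_{v} (Mw θ f) = Mw θ (∂_{v} f) + ⟪v, θ⟫ • f := by
  ext x
  have hfun : (Mw θ f : EuclideanSpace ℝ (Fin d) → ℝ) = fun x => ⟪x, θ⟫ * f x :=
    funext (Mw_apply θ f)
  rw [SchwartzMap.add_apply, Mw_apply, SchwartzMap.smul_apply,
    SchwartzMap.lineDerivOp_apply_eq_fderiv, SchwartzMap.lineDerivOp_apply_eq_fderiv, hfun]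
  have h1 : HasFDerivAt (fun x : EuclideanSpace ℝ (Fin d) => ⟪x, θ⟫) (innerSL ℝ θ) x := by
    have := (innerSL ℝ θ).hasFDerivAt (x := x)
    refine this.congr_of_eventuallyEq (.of_forall fun y => ?_)
    simp [real_inner_comm]
  have h2 : HasFDerivAt (fun x => ⟪x, θ⟫ * f x) _ x :=
    h1.mul (f.differentiableAt (x := x)).hasFDerivAt
  rw [h2.fderiv]
  simp [real_inner_comm v θ]
  ring

theorem sum_coord {d : ℕ} (θ v : EuclideanSpace ℝ (Fin d)) :
    ⟪θ, v⟫ = ∑ j, ⟪canE d j, θ⟫ * ⟪canE d j, v⟫ := by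
  simp only [canE, EuclideanSpace.inner_single_left]
  simp [PiLp.inner_apply, mul_comm]

theorem sum_canE {d : ℕ} (θ : EuclideanSpace ℝ (Fin d)) :
    ∑ j, ⟪canE d j, θ⟫ • canE d j = θ := by
  refine ext_inner_right ℝ fun v => ?_
  rw [sum_inner, sum_coord θ v]
  simp [inner_smul_left]

theorem deriv_sum_canE {d : ℕ} (θ : EuclideanSpace ℝ (Fin d))
    (f : 𝓢(EuclideanSpace ℝ (Fin d), ℝ)) :
    ∑ j, ⟪canE d j, θ⟫ • ∂_{canE d j} f = ∂_{θ} f := by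
  conv_rhs => rw [← sum_canE θ]
  ext x
  simp [SchwartzMap.lineDerivOp_apply_eq_fderiv, SchwartzMap.sum_apply]

theorem RL_lap {d : ℕ} (ω : EuclideanSpace ℝ (Fin d)) (hω : ‖ω‖ = 1)
    (f : 𝓢(EuclideanSpace ℝ (Fin d), ℝ)) (p : ℝ) :
    RL ω p (∑ j, ∂_{canE d j} (∂_{canE d j} f)) = RL ω p (∂_{ω} (∂_{ω} f)) := by
  have key : ∀ j, RL ω p (∂_{canE d j} (∂_{canE d j} f)) =
      (⟪canE d j, ω⟫ * ⟪canE d j, ω⟫) * RL ω p (∂_{ω} (∂_{ω} f)) := by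
    intro j
    have h1 := RL_hasDerivAt ω (∂_{canE d j} f) p
    have h2 := (RL_hasDerivAt ω (∂_{ω} f) p).const_mul ⟪ω, canE d j⟫
    have h3 : (fun q => RL ω q (∂_{canE d j} f)) =
        fun q => ⟪ω, canE d j⟫ * RL ω q (∂_{ω} f) :=
      funext fun q => RL_dir ω _ hω f q
    rw [h3] at h1
    rw [RL_dir ω _ hω, h1.unique h2, real_inner_comm]
    ring
  rw [map_sum, Finset.sum_congr rfl fun j _ => key j, ← Finset.sum_mul, ← sum_coord,
    real_inner_self_eq_norm_sq, hω]
  ring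

theorem Mw_lap {d : ℕ} (θ : EuclideanSpace ℝ (Fin d))
    (f : 𝓢(EuclideanSpace ℝ (Fin d), ℝ)) :
    ∑ j, ∂_{canE d j} (∂_{canE d j} (Mw θ f)) =
      Mw θ (∑ j, ∂_{canE d j} (∂_{canE d j} f)) + (2 : ℝ) • ∂_{θ} f := by
  rw [map_sum, ← deriv_sum_canE θ f, Finset.smul_sum, ← Finset.sum_add_distrib]
  refine Finset.sum_congr rfl fun j _ => ?_
  have : ∂_{canE d j} (⟪canE d j, θ⟫ • f) = ⟪canE d j, θ⟫ • ∂_{canE d j} f :=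
    LineDeriv.lineDerivOp_smul _ _ _
  rw [Mw_deriv, LineDeriv.lineDerivOp_add, Mw_deriv, this]
  module

/-- the weighted longitudinal transform is twice differentiable in `p` and
`[RΦ](ω,p) = [R(⟪x,ω₁⟫⟪ω₁,Ψ(x)⟫)](ω,p) − d²/dp² [W_{ω₁}^∥F](ω,p)`. -/
theorem stmt14 (d : ℕ) (hd : 2 ≤ d)
    (F : EuclideanSpace ℝ (Fin d) → EuclideanSpace ℝ (Fin d))
    (hF : ∀ j : Fin d, IsSchwartz (fun x => ⟪canE d j, F x⟫))
    (Φ : EuclideanSpace ℝ (Fin d) → ℝ) (hΦ : ∀ x, Φ x = vdiv F x)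
    (Ψ : EuclideanSpace ℝ (Fin d) → EuclideanSpace ℝ (Fin d))
    (hΨ : ∀ (j : Fin d) x,
      ⟪canE d j, Ψ x⟫ = lap (fun y => ⟪canE d j, F y⟫) x - fderiv ℝ Φ x (canE d j)) :
    ∀ ω ω₁ : EuclideanSpace ℝ (Fin d), ‖ω‖ = 1 → ‖ω₁‖ = 1 → ⟪ω, ω₁⟫ = 0 → ∀ p : ℝ,
      (∀ q : ℝ, DifferentiableAt ℝ (fun p' => Wlong F ω ω₁ p') q) ∧
      (∀ q : ℝ, DifferentiableAt ℝ (deriv (fun p' => Wlong F ω ω₁ p')) q) ∧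
      RadonT Φ ω p =
        RadonT (fun x => ⟪x, ω₁⟫ * ⟪ω₁, Ψ x⟫) ω p -
          deriv (deriv (fun p' => Wlong F ω ω₁ p')) p := by
  intro ω ω₁ hω hω₁ horth p
  choose G hG using hF
  have hGf : ∀ j, (fun y => ⟪canE d j, F y⟫) = G j := fun j => funext (hG j)
  let c : Fin d → ℝ := fun j => ⟪canE d j, ω₁⟫
  let g : 𝓢(EuclideanSpace ℝ (Fin d), ℝ) := ∑ j, c j • G j
  let P : 𝓢(EuclideanSpace ℝ (Fin d), ℝ) := ∑ j, ∂_{canE d j} (G j)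
  have hP : Φ = P := by
    funext x
    rw [hΦ, vdiv]
    simp only [hGf, P, SchwartzMap.sum_apply, SchwartzMap.lineDerivOp_apply_eq_fderiv]
  have hg : ∀ x, ⟪ω₁, F x⟫ = g x := by
    intro x
    rw [sum_coord]
    simp [g, c, SchwartzMap.sum_apply, hG]
  have hW : (fun p' => Wlong F ω ω₁ p') = fun q => RL ω q (Mw ω₁ g) := by
    funext q
    have : (fun x => ⟪ω₁, x⟫ * ⟪ω₁, F x⟫) = Mw ω₁ g := by
      funext x
      rw [Mw_apply, hg, real_inner_comm]
    rw [Wlong, this]; rfl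
  have hL : ∀ j x, lap (fun y => ⟪canE d j, F y⟫) x =
      (∑ i, ∂_{canE d i} (∂_{canE d i} (G j))) x := by
    intro j x
    rw [hGf, lap, SchwartzMap.sum_apply]
    refine Finset.sum_congr rfl fun i _ => ?_
    rw [SchwartzMap.lineDerivOp_apply_eq_fderiv]
    congr 2
  have hΨ' : (fun x => ⟪x, ω₁⟫ * ⟪ω₁, Ψ x⟫) =
      Mw ω₁ ((∑ i, ∂_{canE d i} (∂_{canE d i} g)) - ∂_{ω₁} P) := by
    funext x
    rw [Mw_apply, sum_coord ω₁ (Ψ x)]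
    congr 1
    have e1 : (∑ i, ∂_{canE d i} (∂_{canE d i} g)) =
        ∑ j, c j • ∑ i, ∂_{canE d i} (∂_{canE d i} (G j)) := by
      simp only [g, LineDeriv.lineDerivOp_sum, LineDeriv.lineDerivOp_smul, Finset.smul_sum]
      exact Finset.sum_comm
    rw [e1, ← deriv_sum_canE ω₁ P, ← Finset.sum_sub_distrib, SchwartzMap.sum_apply]
    refine Finset.sum_congr rfl fun j _ => ?_
    rw [hΨ, hL, hP, SchwartzMap.sub_apply, SchwartzMap.smul_apply, SchwartzMap.smul_apply,
      SchwartzMap.lineDerivOp_apply_eq_fderiv, smul_eq_mul, smul_eq_mul, mul_sub]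
  have hd1 : deriv (fun q => RL ω q (Mw ω₁ g)) = fun q => RL ω q (∂_{ω} (Mw ω₁ g)) :=
    funext fun q => (RL_hasDerivAt ω _ q).deriv
  rw [hW, hd1]
  refine ⟨fun q => (RL_hasDerivAt ω _ q).differentiableAt,
    fun q => (RL_hasDerivAt ω _ q).differentiableAt, ?_⟩
  rw [(RL_hasDerivAt ω _ p).deriv, hΨ', hP]
  change RL ω p P = RL ω p (Mw ω₁ _) - _
  have h1 := RL_lap ω hω (Mw ω₁ g) p
  rw [Mw_lap, map_add, map_smul, RL_orth ω ω₁ horth] at h1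
  have h2 := RL_orth ω ω₁ horth (Mw ω₁ P) p
  rw [Mw_deriv, map_add, map_smul, real_inner_self_eq_norm_sq, hω₁] at h2
  rw [map_sub, map_sub, ← h1]
  simp only [smul_eq_mul] at h2 ⊢
  linarith
end
end
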